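/- Let ω = e^{2πi/3}, let m ≥ 2 and r ≥ 0 be integers, and let λ(m,r) denote the partition with parts λ(m,r)_a = ⌊(r+m−a)/2⌋ for a = 1,…,m. Let S_{λ(m,r)}(z₁,…,z_m) denote the corresponding Schur polynomial, i.e. the polynomial equal to det[(z_i^{λ(m,r)_j + m − j})_{1≤i,j≤m}] / det[(z_i^{m−j})_{1≤i,j≤m}]. Then for any 1 ≤ i ≠ j ≤ m and either sign ε ∈ {+1,−1}, the specialization z_i = ω^{ε} z_j satisfies S_{λ(m,r)}(z₁,…,z_m)|_{z_i=ω^{ε}z_j} = (−ω^{−ε} z_j)^r · Π_{ℓ≠i,j} (z_ℓ − ω^{−ε} z_j) · S_{λ(m−2,r)}(z with z_i and z_j removed). -/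

import Mathlib

noncomputable section

/-- `ω = e^{2πi/3}`. -/
def omega3 : ℂ := Complex.exp (2 * Real.pi * Complex.I / 3)

/-- The Schur polynomial of the staircase partition `λ(m,r)_a = ⌊(r+m−a)/2⌋`
(`a = 1,…,m`), via the bialternant formula
`det[(z_i^{λ_j+m−j})] / det[(z_i^{m−j})]`. -/
def SchurStair (m r : ℕ) (z : Fin m → ℂ) : ℂ :=
  Matrix.det (Matrix.of fun i j : Fin m =>
      z i ^ ((r + m - 1 - (j:ℕ)) / 2 + (m - 1 - (j:ℕ)))) /
    Matrix.det (Matrix.of fun i j : Fin m => z i ^ (m - 1 - (j:ℕ)))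

/-- The tuple `z` with the entries at positions `i` and `j` removed. -/
def removeTwo (m : ℕ) (i j : Fin m) (z : Fin m → ℂ) : Fin (m-2) → ℂ :=
  fun a =>
    if h1 : (a : ℕ) < min i.val j.val then z ⟨a, by have := a.isLt; omega⟩
    else if h2 : (a : ℕ) + 1 < max i.val j.val then z ⟨(a:ℕ)+1, by have := a.isLt; omega⟩
    else z ⟨(a:ℕ)+2, by have := a.isLt; omega⟩

/-- Exponents of the alternant in the numerator of `SchurStair`, in increasing order. -/
def stairExp (r k : ℕ) : ℕ := (r + k) / 2 + k

/-- The alternant in the numerator of `SchurStair`, with columns in increasing order. -/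
def stairMatrix (r n : ℕ) (z : Fin n → ℂ) : Matrix (Fin n) (Fin n) ℂ :=
  Matrix.of fun i k => z i ^ stairExp r k

theorem stairExp_add_two (r k : ℕ) : stairExp r (k + 2) = stairExp r k + 3 := by
  unfold stairExp; omega

theorem schurStair_eq_div (m r : ℕ) (z : Fin m → ℂ) :
    SchurStair m r z = (stairMatrix r m z).det / (Matrix.vandermonde z).det := by
  have hN : (Matrix.of fun i j : Fin m =>
      z i ^ ((r + m - 1 - (j:ℕ)) / 2 + (m - 1 - (j:ℕ)))) =
      (stairMatrix r m z).submatrix id Fin.revPerm := by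
    ext i j
    simp only [stairMatrix, stairExp, Matrix.of_apply, Matrix.submatrix_apply, id,
      Fin.revPerm_apply, Fin.val_rev]
    congr 1
    omega
  have hV : (Matrix.of fun i j : Fin m => z i ^ (m - 1 - (j:ℕ))) =
      (Matrix.vandermonde z).submatrix id Fin.revPerm := by
    ext i j
    simp only [Matrix.vandermonde_apply, Matrix.of_apply, Matrix.submatrix_apply, id,
      Fin.revPerm_apply, Fin.val_rev]
    congr 1
    omega
  rw [SchurStair, hN, hV, Matrix.det_permute', Matrix.det_permute']
  refine mul_div_mul_left _ _ ?_
  exact_mod_cast (Equiv.Perm.sign (Fin.revPerm (n := m))).ne_zero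

theorem schurStair_comp_perm (m r : ℕ) (z : Fin m → ℂ) (σ : Equiv.Perm (Fin m)) :
    SchurStair m r (z ∘ σ) = SchurStair m r z := by
  have hN : stairMatrix r m (z ∘ σ) = (stairMatrix r m z).submatrix σ id := rfl
  have hV : Matrix.vandermonde (z ∘ σ) = (Matrix.vandermonde z).submatrix σ id := rfl
  rw [schurStair_eq_div, schurStair_eq_div, hN, hV, Matrix.det_permute, Matrix.det_permute]
  refine mul_div_mul_left _ _ ?_
  exact_mod_cast (Equiv.Perm.sign σ).ne_zero

theorem det_vandermonde_cons (n : ℕ) (a : ℂ) (y : Fin n → ℂ) :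
    (Matrix.vandermonde (Fin.cons a y : Fin (n + 1) → ℂ)).det =
      (∏ l, (y l - a)) * (Matrix.vandermonde y).det := by
  rw [Matrix.det_vandermonde, Matrix.det_vandermonde, Fin.prod_univ_succ]
  simp [Fin.prod_Ioi_succ]

/-- The column operation subtracting `c` times column `k` from column `k + 2`. -/
def shiftTwo (n : ℕ) (c : ℂ) : Matrix (Fin (n + 2)) (Fin (n + 2)) ℂ :=
  Matrix.of fun k l => (if k = l then 1 else 0) - if (k : ℕ) + 2 = l then c else 0

theorem det_shiftTwo (n : ℕ) (c : ℂ) : (shiftTwo n c).det = 1 := by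
  rw [Matrix.det_of_isUpperTriangular]
  · simp [shiftTwo]
  · intro k l hkl
    have h : (l : ℕ) < k := hkl
    have h1 : k ≠ l := by rintro rfl; omega
    have h2 : (k : ℕ) + 2 ≠ l := by omega
    simp [shiftTwo, h1, h2]

theorem mul_shiftTwo_of_lt_two (n : ℕ) (c : ℂ) (M : Matrix (Fin (n + 2)) (Fin (n + 2)) ℂ)
    (i l : Fin (n + 2)) (hl : (l : ℕ) < 2) : (M * shiftTwo n c) i l = M i l := by
  have h (k : Fin (n + 2)) : (k : ℕ) + 2 ≠ l := by omega
  simp [Matrix.mul_apply, shiftTwo, h]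

theorem mul_shiftTwo_add_two (n : ℕ) (c : ℂ) (M : Matrix (Fin (n + 2)) (Fin (n + 2)) ℂ)
    (i k l : Fin (n + 2)) (hl : (k : ℕ) + 2 = l) :
    (M * shiftTwo n c) i l = M i l - M i k * c := by
  have h (k' : Fin (n + 2)) : (k' : ℕ) + 2 = l ↔ k' = k := by rw [Fin.ext_iff]; omega
  simp [Matrix.mul_apply, shiftTwo, h, mul_sub, Finset.sum_sub_distrib]

theorem det_stairMatrix_cons_cons (r n : ℕ) (x u : ℂ) (hu : u ^ 3 = x ^ 3) (y : Fin n → ℂ) :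
    (stairMatrix r (n + 2) (Fin.cons u (Fin.cons x y : Fin (n + 1) → ℂ))).det =
      (u ^ stairExp r 0 * x ^ stairExp r 1 - u ^ stairExp r 1 * x ^ stairExp r 0) *
        ((∏ l, (y l ^ 3 - x ^ 3)) * (stairMatrix r n y).det) := by
  set z : Fin (n + 2) → ℂ := Fin.cons u (Fin.cons x y : Fin (n + 1) → ℂ) with hz
  let e : Fin 2 ⊕ Fin n ≃ Fin (n + 2) := finSumFinEquiv.trans (finCongr (add_comm 2 n))
  have e0 : e (Sum.inl 0) = 0 := rfl
  have e1 : e (Sum.inl 1) = 1 := rfl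
  have er (a : Fin n) : e (Sum.inr a) = a.succ.succ := by
    ext; simp [e]
  have z1 : z 1 = x := rfl
  have z0 : z 0 = u := rfl
  have zs (a : Fin n) : z a.succ.succ = y a := rfl
  have key (i : Fin (n + 2)) (b : Fin n) :
      (stairMatrix r (n + 2) z * shiftTwo n (x ^ 3)) i b.succ.succ =
        (z i ^ 3 - x ^ 3) * z i ^ stairExp r b := by
    rw [mul_shiftTwo_add_two n _ _ i b.castSucc.castSucc _ (by simp)]
    simp only [stairMatrix, Matrix.of_apply, Fin.val_succ, Fin.val_castSucc]
    rw [add_assoc, stairExp_add_two]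
    ring
  have hblock : (stairMatrix r (n + 2) z * shiftTwo n (x ^ 3)).submatrix e e =
      Matrix.fromBlocks
        !![u ^ stairExp r 0, u ^ stairExp r 1; x ^ stairExp r 0, x ^ stairExp r 1] 0
        (Matrix.of fun a b => y a ^ stairExp r (b : Fin 2))
        (Matrix.diagonal (fun l => y l ^ 3 - x ^ 3) * stairMatrix r n y) := by
    ext i j
    rcases j with j | j
    · have hj : ((e (Sum.inl j) : Fin (n + 2)) : ℕ) = j := by simp [e]
      rw [Matrix.submatrix_apply, mul_shiftTwo_of_lt_two _ _ _ _ _ (by omega), stairMatrix,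
        Matrix.of_apply, hj]
      rcases i with i | i
      · fin_cases i <;> fin_cases j <;> simp [e0, e1, z0, z1]
      · simp [er, zs]
    · rw [Matrix.submatrix_apply, er, key]
      rcases i with i | i
      · fin_cases i <;> simp [e0, e1, z0, z1, hu]
      · simp [er, zs, stairMatrix]
  have := congrArg Matrix.det hblock
  rw [Matrix.det_submatrix_equiv_self, Matrix.det_mul, det_shiftTwo, mul_one,
    Matrix.det_fromBlocks_zero₁₂, Matrix.det_mul, Matrix.det_diagonal, Matrix.det_fin_two_of] at this
  exact this

theorem stairExp_two_by_two (r : ℕ) (x w : ℂ) (hw : w ^ 2 + w + 1 = 0) :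
    (w * x) ^ stairExp r 0 * x ^ stairExp r 1 - (w * x) ^ stairExp r 1 * x ^ stairExp r 0 =
      (-(w ^ 2) * x) ^ r * (x - w * x) := by
  have h3 : -(w ^ 2) = 1 + w := by linear_combination -hw
  have hsq : (1 + w) ^ 2 = w := by linear_combination hw
  rcases Nat.even_or_odd' r with ⟨s, rfl | rfl⟩
  · have a0 : stairExp (2 * s) 0 = s := by unfold stairExp; omega
    have a1 : stairExp (2 * s) 1 = s + 1 := by unfold stairExp; omega
    rw [a0, a1, h3, pow_mul, mul_pow _ x 2, hsq]
    ring
  · have a0 : stairExp (2 * s + 1) 0 = s := by unfold stairExp; omega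
    have a1 : stairExp (2 * s + 1) 1 = s + 2 := by unfold stairExp; omega
    rw [a0, a1, h3, pow_succ _ (2 * s), pow_mul, mul_pow _ x 2, hsq]
    ring

theorem schurStair_cons_cons (r n : ℕ) (x w : ℂ) (hw : w ^ 2 + w + 1 = 0) (y : Fin n → ℂ)
    (hinj : Function.Injective
      (Fin.cons (w * x) (Fin.cons x y : Fin (n + 1) → ℂ) : Fin (n + 2) → ℂ)) :
    SchurStair (n + 2) r (Fin.cons (w * x) (Fin.cons x y : Fin (n + 1) → ℂ)) =
      (-(w ^ 2) * x) ^ r * (∏ l, (y l - w ^ 2 * x)) * SchurStair n r y := by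
  have hw3 : w ^ 3 = 1 := by linear_combination (w - 1) * hw
  have hV := Matrix.det_vandermonde_ne_zero_iff.mpr hinj
  have hfac : ∏ l, (y l ^ 3 - x ^ 3) =
      (∏ l, (y l - w ^ 2 * x)) * (∏ l, (y l - w * x)) * ∏ l, (y l - x) := by
    rw [← Finset.prod_mul_distrib, ← Finset.prod_mul_distrib]
    refine Finset.prod_congr rfl fun l _ => ?_
    linear_combination (y l ^ 2 * x - y l * x ^ 2 * w) * hw + x ^ 3 * hw3
  rw [schurStair_eq_div, schurStair_eq_div,
    det_stairMatrix_cons_cons r n x (w * x) (by rw [mul_pow, hw3, one_mul]) y,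
    stairExp_two_by_two r x w hw, hfac]
  rw [det_vandermonde_cons, det_vandermonde_cons, Fin.prod_univ_succ] at hV ⊢
  simp only [Fin.cons_zero, Fin.cons_succ] at hV ⊢
  have h1 := left_ne_zero_of_mul hV
  have h2 := left_ne_zero_of_mul h1
  have h3 := right_ne_zero_of_mul h1
  have h4 := left_ne_zero_of_mul (right_ne_zero_of_mul hV)
  have h5 := right_ne_zero_of_mul (right_ne_zero_of_mul hV)
  generalize x - w * x = d at *
  field_simp

theorem omega3_sq_add (ε : ℤ) (hε : ε = 1 ∨ ε = -1) :
    (omega3 ^ ε) ^ 2 + omega3 ^ ε + 1 = 0 := by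
  have hp : IsPrimitiveRoot omega3 3 := by
    simpa [omega3] using Complex.isPrimitiveRoot_exp 3 (by norm_num)
  have h := hp.geom_sum_eq_zero (by norm_num)
  simp only [Finset.sum_range_succ, Finset.sum_range_zero, zero_add, pow_zero, pow_one] at h
  have h0 : omega3 ≠ 0 := hp.ne_zero (by norm_num)
  rcases hε with rfl | rfl
  · rw [zpow_one]
    linear_combination h
  · rw [zpow_neg_one]
    field_simp
    linear_combination h

/-- The order embedding of `Fin n` into `Fin (n + 2)` whose image omits `i` and `j`. -/
def skipTwo {n : ℕ} (i j : Fin (n + 2)) (a : Fin n) : Fin (n + 2) :=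
  if (a : ℕ) < min i.val j.val then ⟨a, by omega⟩
  else if (a : ℕ) + 1 < max i.val j.val then ⟨a + 1, by omega⟩
  else ⟨a + 2, by omega⟩

theorem removeTwo_eq_comp {n : ℕ} (i j : Fin (n + 2)) (z : Fin (n + 2) → ℂ) :
    removeTwo (n + 2) i j z = z ∘ skipTwo i j := by
  funext a
  simp only [removeTwo, skipTwo, Function.comp_apply]
  split_ifs <;> rfl

theorem val_skipTwo {n : ℕ} (i j : Fin (n + 2)) (a : Fin n) :
    (skipTwo i j a : ℕ) = if (a : ℕ) < min i.val j.val then (a : ℕ)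
      else if (a : ℕ) + 1 < max i.val j.val then a + 1 else a + 2 := by
  unfold skipTwo
  split_ifs <;> rfl

theorem skipTwo_ne {n : ℕ} {i j : Fin (n + 2)} (hij : i ≠ j) (a : Fin n) :
    skipTwo i j a ≠ i ∧ skipTwo i j a ≠ j := by
  have hij' := Fin.val_ne_of_ne hij
  simp only [ne_eq, Fin.ext_iff, val_skipTwo]
  split_ifs <;> omega

theorem skipTwo_injective {n : ℕ} (i j : Fin (n + 2)) : Function.Injective (skipTwo i j) := by
  intro a b hab
  rw [Fin.ext_iff, val_skipTwo, val_skipTwo] at hab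
  rw [Fin.ext_iff]
  split_ifs at hab <;> omega

theorem cons_cons_skipTwo_bijective {n : ℕ} {i j : Fin (n + 2)} (hij : i ≠ j) :
    Function.Bijective
      (Fin.cons i (Fin.cons j (skipTwo i j) : Fin (n + 1) → Fin (n + 2)) :
        Fin (n + 2) → Fin (n + 2)) := by
  refine Finite.injective_iff_bijective.mp ?_
  rw [Fin.cons_injective_iff, Fin.cons_injective_iff]
  refine ⟨?_, ?_, skipTwo_injective i j⟩
  · rintro ⟨a, ha⟩
    cases a using Fin.cases with
    | zero => exact hij ha.symm
    | succ a => exact (skipTwo_ne hij a).1 ha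
  · rintro ⟨a, ha⟩
    exact (skipTwo_ne hij a).2 ha

theorem schur_recursion (m r : ℕ) (hm : 2 ≤ m) (i j : Fin m) (hij : i ≠ j)
    (ε : ℤ) (hε : ε = 1 ∨ ε = -1) (z : Fin m → ℂ)
    (hinj : Function.Injective (Function.update z i (omega3 ^ ε * z j))) :
    SchurStair m r (Function.update z i (omega3 ^ ε * z j)) =
      (-(omega3 ^ (-ε)) * z j) ^ r *
        (∏ l : Fin m, if l ≠ i ∧ l ≠ j then (z l - omega3 ^ (-ε) * z j) else 1) *
        SchurStair (m-2) r (removeTwo m i j z) := by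
  obtain ⟨n, rfl⟩ := Nat.exists_eq_add_of_le' hm
  have hw := omega3_sq_add ε hε
  set w := omega3 ^ ε with hw_def
  have hinv : omega3 ^ (-ε) = w ^ 2 := by
    rw [zpow_neg, ← hw_def]
    exact inv_eq_of_mul_eq_one_right (by linear_combination (w - 1) * hw)
  rw [hinv]
  let σ : Equiv.Perm (Fin (n + 2)) := Equiv.ofBijective _ (cons_cons_skipTwo_bijective hij)
  have σ0 : σ 0 = i := rfl
  have σ1 : σ (Fin.succ 0) = j := rfl
  have σs (a : Fin n) : σ a.succ.succ = skipTwo i j a := rfl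
  have hcomp : Function.update z i (w * z j) ∘ σ =
      Fin.cons (w * z j) (Fin.cons (z j) (removeTwo (n + 2) i j z) : Fin (n + 1) → ℂ) := by
    funext a
    cases a using Fin.cases with
    | zero => simp [σ0]
    | succ a =>
      cases a using Fin.cases with
      | zero => simp only [Function.comp_apply, σ1, Fin.cons_succ, Fin.cons_zero,
          Function.update_of_ne hij.symm]
      | succ a => simp only [Function.comp_apply, σs, Fin.cons_succ, removeTwo_eq_comp,
          Function.update_of_ne (skipTwo_ne hij a).1]
  have hprod : (∏ l, if l ≠ i ∧ l ≠ j then z l - w ^ 2 * z j else 1) =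
      ∏ a : Fin n, (removeTwo (n + 2) i j z a - w ^ 2 * z j) := by
    rw [← Equiv.prod_comp σ, Fin.prod_univ_succ, Fin.prod_univ_succ, σ0, σ1]
    simp [σs, removeTwo_eq_comp, (skipTwo_ne hij _).1, (skipTwo_ne hij _).2]
  rw [← schurStair_comp_perm _ _ _ σ, hcomp, hprod]
  refine schurStair_cons_cons r n (z j) w hw _ ?_
  rw [← hcomp]
  exact hinj.comp σ.injective
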